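/- Let β ∈ (0,1], let p, q be positive integers, and define K_β = 1/(4β) if 0 < β ≤ (4−√10)/6, K_β = (4−3β)/2 if (4−√10)/6 < β ≤ 2/3, and K_β = 1 if 2/3 ≤ β ≤ 1. For all A₁, A₂ ∈ Skew(p) and B₁, B₂ ∈ ℝ^{q×p} satisfying β‖A_i‖_F² + ‖B_i‖_F² = 1 for i = 1,2 and β·tr(A₁ᵀA₂) + tr(B₁ᵀB₂) = 0, the quantity 𝒦_β(Δ₁,Δ₂) = (1/2)‖B₁B₂ᵀ − B₂B₁ᵀ‖_F² + ((1−2β)³/2)‖B₁ᵀB₂ − B₂ᵀB₁‖_F² + β²‖B₁A₂ − B₂A₁‖_F² + (β/4)‖A₁A₂ − A₂A₁ − (3−4β)(B₁ᵀB₂ − B₂ᵀB₁)‖_F² satisfies 𝒦_β(Δ₁,Δ₂) ≤ K_β. (This is the statement that the sectional curvature of the Stiefel manifold St_β(n,p), with q = n−p, is bounded above by K_β.) -/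

import Mathlib

open Matrix

/-- The squared Frobenius norm of a real matrix. -/
noncomputable def frobSq {m n : Type*} [Fintype m] [Fintype n] (A : Matrix m n ℝ) : ℝ :=
  ∑ i, ∑ j, (A i j) ^ 2

section Frobenius

variable {m n : Type*} [Fintype m] [Fintype n]

theorem frobSq_nonneg (A : Matrix m n ℝ) : 0 ≤ frobSq A :=
  Finset.sum_nonneg fun _ _ => Finset.sum_nonneg fun _ _ => sq_nonneg _

theorem trace_transpose_mul_eq_sum (A B : Matrix m n ℝ) :
    (Aᵀ * B).trace = ∑ i, ∑ j, A i j * B i j := by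
  simp only [Matrix.trace, Matrix.diag, Matrix.mul_apply, Matrix.transpose_apply]
  exact Finset.sum_comm

theorem frobSq_eq_trace (A : Matrix m n ℝ) : frobSq A = (Aᵀ * A).trace := by
  rw [trace_transpose_mul_eq_sum]
  simp only [frobSq, sq]

theorem frobSq_transpose (A : Matrix m n ℝ) : frobSq Aᵀ = frobSq A :=
  Finset.sum_comm

theorem frobSq_sub_smul (A B : Matrix m n ℝ) (k : ℝ) :
    frobSq (A - k • B) = frobSq A - 2 * k * (Aᵀ * B).trace + k ^ 2 * frobSq B := by
  simp only [trace_transpose_mul_eq_sum, frobSq, Finset.mul_sum, ← Finset.sum_sub_distrib,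
    ← Finset.sum_add_distrib, Matrix.sub_apply, Matrix.smul_apply, smul_eq_mul]
  exact Finset.sum_congr rfl fun i _ => Finset.sum_congr rfl fun j _ => by ring

theorem frobSq_sub_le (A B : Matrix m n ℝ) :
    frobSq (A - B) ≤ 2 * frobSq A + 2 * frobSq B := by
  have h₁ := frobSq_sub_smul A B 1
  have h₂ := frobSq_sub_smul A B (-1)
  have h₃ := frobSq_nonneg (A - (-1 : ℝ) • B)
  rw [one_smul] at h₁
  linarith

/-- The Cauchy–Schwarz inequality for the Frobenius inner product. -/
theorem trace_transpose_mul_sq_le (A B : Matrix m n ℝ) :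
    (Aᵀ * B).trace ^ 2 ≤ frobSq A * frobSq B := by
  rw [trace_transpose_mul_eq_sum]
  simp only [frobSq, ← Fintype.sum_prod_type']
  exact Finset.sum_mul_sq_le_sq_mul_sq _ _ _

/-- A skew-symmetric matrix has squared spectral norm at most half its squared Frobenius norm. -/
theorem sum_sq_mulVec_le_of_skew (A : Matrix n n ℝ) (hA : Aᵀ = -A) (v : n → ℝ) :
    2 * ∑ i, (A *ᵥ v) i ^ 2 ≤ frobSq A * ∑ i, v i ^ 2 := by
  set w := A *ᵥ v with hw
  set W := ∑ i, w i ^ 2 with hW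
  set V := ∑ i, v i ^ 2 with hV
  have hWAv : ∑ i, ∑ j, A i j * (w i * v j) = W := by
    rw [hW]
    refine Finset.sum_congr rfl fun i _ => ?_
    rw [sq]
    nth_rw 3 [hw]
    simp only [Matrix.mulVec, dotProduct, Finset.mul_sum]
    exact Finset.sum_congr rfl fun j _ => by ring
  have hAskew : ∀ i j, A j i = -A i j := fun i j => congrFun (congrFun hA i) j
  have hvw : ∑ i, ∑ j, A i j * (v i * w j) = -W := by
    rw [Finset.sum_comm, ← hWAv, ← Finset.sum_neg_distrib]
    refine Finset.sum_congr rfl fun i _ => ?_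
    rw [← Finset.sum_neg_distrib]
    exact Finset.sum_congr rfl fun j _ => by rw [hAskew i j]; ring
  have hprod : ∀ a b : n → ℝ, ∑ i, ∑ j, a i * b j = (∑ i, a i) * ∑ j, b j := fun a b => by
    rw [Finset.sum_mul_sum]
  set Z : Matrix n n ℝ := Matrix.of fun i j => w i * v j - v i * w j with hZ
  have hAZ : (Aᵀ * Z).trace = 2 * W := by
    rw [trace_transpose_mul_eq_sum]
    simp only [hZ, Matrix.of_apply, mul_sub, Finset.sum_sub_distrib, hWAv, hvw]
    ring
  have hZZ : frobSq Z ≤ 2 * (W * V) := by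
    have : frobSq Z = 2 * (W * V) - 2 * (∑ i, w i * v i) ^ 2 := by
      have h₁ : 2 * (W * V) = ∑ i, ∑ j, w i ^ 2 * v j ^ 2 + ∑ i, ∑ j, v i ^ 2 * w j ^ 2 := by
        rw [hprod, hprod]
        ring
      rw [h₁, sq, ← hprod]
      simp only [frobSq, hZ, Matrix.of_apply, Finset.mul_sum, ← Finset.sum_sub_distrib,
        ← Finset.sum_add_distrib]
      exact Finset.sum_congr rfl fun i _ => Finset.sum_congr rfl fun j _ => by ring
    nlinarith [sq_nonneg (∑ i, w i * v i)]
  have hCS := trace_transpose_mul_sq_le A Z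
  rw [hAZ] at hCS
  have hW0 : 0 ≤ W := Finset.sum_nonneg fun _ _ => sq_nonneg _
  have hV0 : 0 ≤ V := Finset.sum_nonneg fun _ _ => sq_nonneg _
  have hA0 := frobSq_nonneg A
  rcases hW0.eq_or_lt with h | h
  · rw [← h]
    simpa using mul_nonneg hA0 hV0
  · have := mul_le_mul_of_nonneg_left hZZ hA0
    refine le_of_mul_le_mul_left ?_ h
    nlinarith

theorem frobSq_mul_le_of_skew (B : Matrix m n ℝ) (A : Matrix n n ℝ) (hA : Aᵀ = -A) :
    2 * frobSq (B * A) ≤ frobSq A * frobSq B := by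
  have h : ∀ i, 2 * ∑ j, (B * A) i j ^ 2 ≤ frobSq A * ∑ j, B i j ^ 2 := fun i => by
    refine le_of_eq_of_le ?_ (sum_sq_mulVec_le_of_skew A hA (B i))
    congr 1
    refine Finset.sum_congr rfl fun j _ => ?_
    have : (A *ᵥ B i) j = -(B * A) i j := by
      simp only [Matrix.mulVec, dotProduct, Matrix.mul_apply, ← Finset.sum_neg_distrib]
      refine Finset.sum_congr rfl fun k _ => ?_
      rw [show A j k = -A k j from congrFun (congrFun hA k) j]
      ring
    rw [this, neg_sq]
  simp only [frobSq] at h ⊢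
  rw [Finset.mul_sum, Finset.mul_sum]
  exact Finset.sum_le_sum fun i _ => h i

theorem frobSq_mul_transpose_sub_le (B₁ B₂ : Matrix m n ℝ) :
    frobSq (B₁ * B₂ᵀ - B₂ * B₁ᵀ) ≤ 2 * (frobSq B₁ * frobSq B₂) := by
  set M := B₁ * B₂ᵀ - B₂ * B₁ᵀ with hM
  have hskew : Mᵀ = -M := by simp [hM]
  have htr : (B₁ᵀ * (B₂ᵀ * M)ᵀ).trace = (Mᵀ * (B₂ * B₁ᵀ)).trace := by
    rw [Matrix.transpose_mul, Matrix.transpose_transpose, Matrix.trace_mul_comm, Matrix.mul_assoc]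
  have hself : frobSq M = -2 * (B₁ᵀ * (B₂ᵀ * M)ᵀ).trace := by
    have h : (Mᵀ * (B₂ * B₁ᵀ)).trace = -(Mᵀ * (B₁ * B₂ᵀ)).trace := by
      rw [← Matrix.trace_transpose, Matrix.transpose_mul, Matrix.trace_mul_comm]
      simp [hskew]
    rw [htr, frobSq_eq_trace]
    nth_rw 2 [hM]
    rw [Matrix.mul_sub, Matrix.trace_sub, h]
    ring
  have hCS := trace_transpose_mul_sq_le B₁ (B₂ᵀ * M)ᵀ
  have hop := frobSq_mul_le_of_skew B₂ᵀ M hskew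
  rw [frobSq_transpose] at hCS hop
  have h0 := frobSq_nonneg M
  have h1 := frobSq_nonneg B₁
  have h2 := frobSq_nonneg B₂
  rcases h0.eq_or_lt with h | h
  · rw [← h]; positivity
  · refine le_of_mul_le_mul_left ?_ h
    nlinarith [mul_le_mul_of_nonneg_left hop h1]

end Frobenius

section SkewCommutator

variable {n : Type*} [Fintype n]

theorem trace_conjTranspose_mul_self_eq_sum (Z : Matrix n n ℂ) :
    (Zᴴ * Z).trace = ((∑ i, ∑ j, Complex.normSq (Z i j) : ℝ) : ℂ) := by
  simp only [Matrix.trace, Matrix.diag, Matrix.mul_apply, Matrix.conjTranspose_apply]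
  rw [Finset.sum_comm]
  push_cast
  exact Finset.sum_congr rfl fun i _ => Finset.sum_congr rfl fun j _ => by
    rw [Complex.normSq_eq_conj_mul_self]; rfl

variable [DecidableEq n]

theorem sq_sub_le_sum_sq_of_symmetric (lam : n → ℝ) (hsymm : ∀ k, ∃ j, lam j = -lam k) (j k : n)
    (hj : lam j = -lam k → ∃ l, l ≠ j ∧ lam l = lam j)
    (hk : lam j = -lam k → ∃ l, l ≠ k ∧ lam l = lam k) :
    (lam j - lam k) ^ 2 ≤ ∑ i, lam i ^ 2 := by
  have hsub : ∀ s : Finset n, ∑ i ∈ s, lam i ^ 2 ≤ ∑ i, lam i ^ 2 := fun s =>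
    Finset.sum_le_sum_of_subset_of_nonneg (Finset.subset_univ _) fun _ _ _ => sq_nonneg _
  have hfour : ∀ a b c d : n, a ≠ b → a ≠ c → a ≠ d → b ≠ c → b ≠ d → c ≠ d →
      lam a ^ 2 + (lam b ^ 2 + (lam c ^ 2 + lam d ^ 2)) ≤ ∑ i, lam i ^ 2 := by
    intro a b c d hab hac had hbc hbd hcd
    have := hsub {a, b, c, d}
    rwa [Finset.sum_insert (by simp [hab, hac, had]), Finset.sum_insert (by simp [hbc, hbd]),
      Finset.sum_pair hcd] at this
  have hone : ∀ a, lam a ^ 2 ≤ ∑ i, lam i ^ 2 := fun a => by simpa using hsub {a}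
  have hne : ∀ a b, lam a ≠ lam b → a ≠ b := fun a b h hab => h (hab ▸ rfl)
  by_cases hjk : lam j = lam k
  · rw [hjk, sub_self]
    simpa using Finset.sum_nonneg fun i _ => sq_nonneg (lam i)
  by_cases hj0 : lam j = 0
  · simpa [hj0] using hone k
  by_cases hk0 : lam k = 0
  · simpa [hk0] using hone j
  by_cases hopp : lam j = -lam k
  · obtain ⟨a, haj, ha⟩ := hj hopp
    obtain ⟨b, hbk, hb⟩ := hk hopp
    have := hfour j a k b haj.symm (hne _ _ hjk) (hne _ _ (by rw [hb]; exact hjk))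
      (hne _ _ (by rw [ha]; exact hjk)) (hne _ _ (by rw [ha, hb]; exact hjk)) hbk.symm
    rw [ha, hb] at this
    nlinarith [sq_nonneg (lam j + lam k)]
  · obtain ⟨a, ha⟩ := hsymm j
    obtain ⟨b, hb⟩ := hsymm k
    have := hfour j a k b (hne _ _ fun h => hj0 (by linarith)) (hne _ _ hjk)
      (hne _ _ fun h => hopp (by linarith)) (hne _ _ fun h => hopp (by linarith))
      (hne _ _ fun h => hjk (by linarith)) (hne _ _ fun h => hk0 (by linarith))
    rw [ha, hb] at this
    nlinarith [sq_nonneg (lam j + lam k)]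

theorem sum_normSq_unitary_conj (U Z : Matrix n n ℂ) (hU : U * Uᴴ = 1) :
    ∑ i, ∑ j, Complex.normSq ((Uᴴ * Z * U) i j) = ∑ i, ∑ j, Complex.normSq (Z i j) := by
  have h : ((Uᴴ * Z * U)ᴴ * (Uᴴ * Z * U)).trace = (Zᴴ * Z).trace := by
    have : (Uᴴ * Z * U)ᴴ * (Uᴴ * Z * U) = Uᴴ * (Zᴴ * (U * Uᴴ) * Z * U) := by
      simp only [Matrix.conjTranspose_mul, Matrix.conjTranspose_conjTranspose, Matrix.mul_assoc]
    rw [this, Matrix.trace_mul_comm, hU, Matrix.mul_one, Matrix.mul_assoc, hU, Matrix.mul_one]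
  rw [trace_conjTranspose_mul_self_eq_sum, trace_conjTranspose_mul_self_eq_sum] at h
  exact_mod_cast h

theorem sum_normSq_commutator_le (H Y : Matrix n n ℂ) (hH : H.IsHermitian) (hHt : Hᵀ = -H)
    (hY : Yᴴ = -Y) (hYt : Yᵀ = -Y) :
    ∑ i, ∑ j, Complex.normSq ((H * Y - Y * H) i j) ≤
      (∑ i, ∑ j, Complex.normSq (H i j)) * ∑ i, ∑ j, Complex.normSq (Y i j) := by
  set U : Matrix n n ℂ := (hH.eigenvectorUnitary : Matrix n n ℂ)
  set lam := hH.eigenvalues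
  set D : Matrix n n ℂ := Matrix.diagonal fun i => (lam i : ℂ) with hD
  have hUU : Uᴴ * U = 1 := Unitary.coe_star_mul_self hH.eigenvectorUnitary
  have hUU' : U * Uᴴ = 1 := Unitary.coe_mul_star_self hH.eigenvectorUnitary
  have hHD : H = U * D * Uᴴ := hH.spectral_theorem
  have hHU : H * U = U * D := by rw [hHD, Matrix.mul_assoc, hUU, Matrix.mul_one]
  have hUH : Uᴴ * H = D * Uᴴ := by
    rw [hHD, ← Matrix.mul_assoc, ← Matrix.mul_assoc, hUU, Matrix.one_mul]
  set W := Uᵀ * U with hW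
  set Y' := Uᴴ * Y * U with hY'
  have hWt : Wᵀ = W := by simp [hW]
  have hWU : W * Uᴴ = Uᵀ := by rw [hW, Matrix.mul_assoc, hUU', Matrix.mul_one]
  have hWunit : W * Wᴴ = 1 := by
    have h₁ : Wᴴ = Uᴴ * Uᵀᴴ := by simp [hW]
    have h₂ : Uᵀᴴ = Uᴴᵀ := rfl
    rw [h₁, ← Matrix.mul_assoc, hWU, h₂, ← Matrix.transpose_mul, hUU, Matrix.transpose_one]
  have hDW : D * W = -(W * D) := by
    have : (H * U)ᵀ = D * Uᵀ := by rw [hHU]; simp [hD]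
    rw [Matrix.transpose_mul, hHt] at this
    rw [hW, ← Matrix.mul_assoc, ← this, Matrix.mul_assoc Uᵀ U D, ← hHU]
    simp [Matrix.mul_assoc]
  have hWzero : ∀ j k, lam j ≠ -lam k → W j k = 0 := by
    intro j k hjk
    have h := congrFun (congrFun hDW j) k
    rw [hD, Matrix.diagonal_mul, Matrix.neg_apply, Matrix.mul_diagonal] at h
    have h' : ((lam j + lam k : ℝ) : ℂ) * W j k = 0 := by push_cast; linear_combination h
    rcases mul_eq_zero.1 h' with h0 | h0
    · exact absurd (by linarith [Complex.ofReal_eq_zero.1 h0]) hjk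
    · exact h0
  have hWrow : ∀ k, ∃ j, W k j ≠ 0 := by
    intro k
    by_contra! h
    have := congrFun (congrFun hWunit k) k
    simp [Matrix.mul_apply, h] at this
  have hsymm : ∀ k, ∃ j, lam j = -lam k := by
    intro k
    obtain ⟨j, hj⟩ := hWrow k
    refine ⟨j, ?_⟩
    by_contra h
    exact hj (hWzero k j fun h' => h (by linarith))
  have hWY : Y'ᵀ * W = -(W * Y') := by
    have h : W * Y' = Uᵀ * Y * U := by
      rw [hY', ← Matrix.mul_assoc, ← Matrix.mul_assoc, hWU]
    rw [← Matrix.transpose_inj, Matrix.transpose_mul, Matrix.transpose_transpose, hWt, h]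
    simp [hYt, Matrix.mul_assoc]
  have hsimple : ∀ j k, lam j = -lam k → Y' j k ≠ 0 → ∃ l, l ≠ j ∧ lam l = lam j := by
    intro j k hjk hne
    by_contra! huniq
    have hz : ∀ l, l ≠ j → W k l = 0 := fun l hl =>
      hWzero k l fun h => huniq l hl (by linarith)
    have hWkj : W k j ≠ 0 := by
      obtain ⟨l, hl⟩ := hWrow k
      by_cases hlj : l = j
      · exact hlj ▸ hl
      · exact absurd (hz l hlj) hl
    have h := congrFun (congrFun hWY k) k
    have hWs : ∀ l, W l k = W k l := fun l => congrFun (congrFun hWt k) l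
    rw [Matrix.neg_apply, Matrix.mul_apply, Matrix.mul_apply] at h
    simp only [Matrix.transpose_apply, hWs] at h
    rw [Finset.sum_eq_single j (fun l _ hl => by rw [hz l hl, mul_zero]) (by simp),
      Finset.sum_eq_single j (fun l _ hl => by rw [hz l hl, zero_mul]) (by simp)] at h
    exact mul_ne_zero hne hWkj (by linear_combination h / 2)
  have hY'h : Y'ᴴ = -Y' := by
    simp [hY', Matrix.conjTranspose_mul, hY, Matrix.mul_assoc]
  have hne_symm : ∀ j k, Y' j k ≠ 0 → Y' k j ≠ 0 := by
    intro j k h h'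
    have := congrFun (congrFun hY'h j) k
    rw [Matrix.conjTranspose_apply, h', star_zero, Matrix.neg_apply] at this
    exact h (neg_eq_zero.1 this.symm)
  have hcomm : Uᴴ * (H * Y - Y * H) * U = D * Y' - Y' * D := by
    rw [Matrix.mul_sub, Matrix.sub_mul, ← Matrix.mul_assoc, hUH]
    simp only [hY', Matrix.mul_assoc, hHU]
  have hHnorm : ∑ i, ∑ j, Complex.normSq (H i j) = ∑ i, lam i ^ 2 := by
    have hconj : Uᴴ * H * U = D := by
      rw [hUH, Matrix.mul_assoc, hUU, Matrix.mul_one]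
    rw [← sum_normSq_unitary_conj U H hUU', hconj]
    refine Finset.sum_congr rfl fun i _ => ?_
    rw [Finset.sum_eq_single i (fun j _ hj => by simp [hD, Matrix.diagonal_apply_ne' _ hj])
      (by simp)]
    simp [hD, Complex.normSq_ofReal, sq]
  rw [← sum_normSq_unitary_conj U _ hUU', hcomm, hHnorm, ← sum_normSq_unitary_conj U Y hUU',
    Finset.mul_sum]
  refine Finset.sum_le_sum fun j _ => ?_
  rw [Finset.mul_sum]
  refine Finset.sum_le_sum fun k _ => ?_
  have hentry : (D * Y' - Y' * D) j k = ((lam j - lam k : ℝ) : ℂ) * Y' j k := by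
    rw [Matrix.sub_apply, hD, Matrix.diagonal_mul, Matrix.mul_diagonal]
    push_cast
    ring
  rw [hentry, Complex.normSq_mul, Complex.normSq_ofReal, ← sq]
  by_cases h0 : Y' j k = 0
  · simp [← hY', h0]
  · exact mul_le_mul_of_nonneg_right
      (sq_sub_le_sum_sq_of_symmetric lam hsymm j k (fun h => hsimple j k h h0) fun h =>
        hsimple k j (by linarith) (hne_symm j k h0)) (Complex.normSq_nonneg _)

theorem frobSq_commutator_le_of_skew (A₁ A₂ : Matrix n n ℝ) (hA₁ : A₁ᵀ = -A₁) (hA₂ : A₂ᵀ = -A₂) :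
    frobSq (A₁ * A₂ - A₂ * A₁) ≤ frobSq A₁ * frobSq A₂ := by
  have h₁ : ∀ i j, A₁ j i = -A₁ i j := fun i j => congrFun (congrFun hA₁ i) j
  have h₂ : ∀ i j, A₂ j i = -A₂ i j := fun i j => congrFun (congrFun hA₂ i) j
  set H : Matrix n n ℂ := Complex.I • A₁.map Complex.ofReal with hH
  set Y : Matrix n n ℂ := A₂.map Complex.ofReal with hY
  have hHY : H * Y - Y * H = Complex.I • (A₁ * A₂ - A₂ * A₁).map Complex.ofReal := by
    ext i j
    simp [hH, hY, Matrix.mul_apply, Finset.mul_sum, mul_sub]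
  have h := sum_normSq_commutator_le H Y
    (by ext i j; simp [hH, h₁ i j]) (by ext i j; simp [hH, h₁ i j])
    (by ext i j; simp [hY, h₂ i j]) (by ext i j; simp [hY, h₂ i j])
  have hI : ∀ Z : Matrix n n ℝ,
      ∑ i, ∑ j, Complex.normSq ((Complex.I • Z.map Complex.ofReal) i j) = frobSq Z := fun Z => by
    simp [frobSq, Complex.normSq_ofReal, sq]
  rw [hHY, hI, hH, hI] at h
  simpa [hY, frobSq, Complex.normSq_ofReal, ← sq] using h

end SkewCommutator

set_option maxHeartbeats 1000000 in
theorem curvature_scalar_bound {β x₁ x₂ y₁ y₂ c n m t s : ℝ} (hβ0 : 0 < β) (hβ1 : β ≤ 1)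
    (hx₁ : 0 ≤ x₁) (hx₂ : 0 ≤ x₂) (hy₁ : 0 ≤ y₁) (hy₂ : 0 ≤ y₂) (hc : 0 ≤ c) (hn : 0 ≤ n)
    (hn₁ : β * x₁ + y₁ = 1) (hn₂ : β * x₂ + y₂ = 1)
    (hM : m ≤ 2 * (y₁ * y₂)) (hN : n ≤ 2 * (y₁ * y₂)) (hC : c ≤ x₁ * x₂)
    (ht : t ≤ x₁ * y₂ + x₂ * y₁) (hs : s ^ 2 ≤ c * n)
    (hs' : 2 * β * s ≤ β ^ 2 * c + n) :
    1 / 2 * m + (1 - 2 * β) ^ 3 / 2 * n + β ^ 2 * t +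
        β / 4 * (c - 2 * (3 - 4 * β) * s + (3 - 4 * β) ^ 2 * n) ≤
      if β ≤ (4 - Real.sqrt 10) / 6 then 1 / (4 * β)
      else if β ≤ 2 / 3 then (4 - 3 * β) / 2
      else 1 := by
  have hyy : 0 ≤ y₁ * y₂ := mul_nonneg hy₁ hy₂
  have hxx : 0 ≤ x₁ * x₂ := mul_nonneg hx₁ hx₂
  have hxy : 0 ≤ x₁ * y₂ + x₂ * y₁ := add_nonneg (mul_nonneg hx₁ hy₂) (mul_nonneg hx₂ hy₁)
  have hone : β ^ 2 * (x₁ * x₂) + β * (x₁ * y₂ + x₂ * y₁) + y₁ * y₂ = 1 := by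
    linear_combination (β * x₂ + y₂) * hn₁ + hn₂
  have hexp : 1 / 2 * m + (1 - 2 * β) ^ 3 / 2 * n + β ^ 2 * t +
        β / 4 * (c - 2 * (3 - 4 * β) * s + (3 - 4 * β) ^ 2 * n) =
      1 / 2 * m + (1 / 2 - 3 / 4 * β) * n + β ^ 2 * t + β / 4 * c - β * (3 - 4 * β) / 2 * s := by
    ring
  rw [hexp]
  have ht' : β ^ 2 * t ≤ β ^ 2 * (x₁ * y₂ + x₂ * y₁) := by gcongr
  have hsmall : ∀ K : ℝ, β ≤ 3 / 4 → 1 ≤ K → 2 - 3 / 2 * β ≤ K → 1 ≤ K * (4 * β) →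
      1 / 2 * m + (1 / 2 - 3 / 4 * β) * n + β ^ 2 * t + β / 4 * c - β * (3 - 4 * β) / 2 * s ≤
        K := by
    intro K hβ hK1 hK2 hK3
    have hsabs : -(x₁ * y₂ + x₂ * y₁) ≤ s := by
      refine (abs_le.1 (abs_le_of_sq_le_sq ?_ hxy)).1
      have : c * n ≤ (x₁ * x₂) * (2 * (y₁ * y₂)) := mul_le_mul hC hN hn hxx
      nlinarith [sq_nonneg (x₁ * y₂ - x₂ * y₁), mul_nonneg hxx hyy]
    have h₁ : 0 ≤ β * (3 - 4 * β) / 2 := by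
      have : 0 ≤ 3 - 4 * β := by linarith
      positivity
    have h₂ := mul_le_mul_of_nonneg_left hsabs h₁
    have h₃ : β / 4 * c ≤ K * (β ^ 2 * (x₁ * x₂)) := by
      have := mul_le_mul_of_nonneg_left hC hβ0.le
      nlinarith [mul_le_mul_of_nonneg_right hK3 (mul_nonneg hβ0.le hxx)]
    have h₄ : (3 / 2 - β) * (β * (x₁ * y₂ + x₂ * y₁)) ≤ K * (β * (x₁ * y₂ + x₂ * y₁)) :=
      mul_le_mul_of_nonneg_right (by linarith) (mul_nonneg hβ0.le hxy)
    have h₅ : 1 / 2 * m + (1 / 2 - 3 / 4 * β) * n ≤ K * (y₁ * y₂) := by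
      rcases le_total β (2 / 3) with h | h
      · nlinarith [mul_le_mul_of_nonneg_left hN (show 0 ≤ 1 / 2 - 3 / 4 * β by linarith),
          mul_le_mul_of_nonneg_right hK2 hyy]
      · nlinarith [mul_nonneg (show 0 ≤ 3 / 4 * β - 1 / 2 by linarith) hn,
          mul_le_mul_of_nonneg_right hK1 hyy]
    have h₆ : K * (β ^ 2 * (x₁ * x₂)) + K * (β * (x₁ * y₂ + x₂ * y₁)) + K * (y₁ * y₂) = K := by
      linear_combination K * hone
    linarith
  have hlarge : 3 / 4 ≤ β →
      1 / 2 * m + (1 / 2 - 3 / 4 * β) * n + β ^ 2 * t + β / 4 * c - β * (3 - 4 * β) / 2 * s ≤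
        1 := by
    intro hβ
    have h₁ := mul_le_mul_of_nonneg_left hs' (show 0 ≤ (4 * β - 3) / 4 by linarith)
    have h₂ : 0 ≤ (1 - β) / 4 * n := mul_nonneg (by linarith) hn
    have h₃ : 0 ≤ β * (7 * β - 1 - 4 * β ^ 2) / 4 * c :=
      mul_nonneg (div_nonneg (mul_nonneg hβ0.le (by nlinarith)) (by norm_num)) hc
    have h₄ : β ^ 2 * c ≤ β ^ 2 * (x₁ * x₂) := by gcongr
    have h₅ : 0 ≤ (1 - β) * (β * (x₁ * y₂ + x₂ * y₁)) :=
      mul_nonneg (by linarith) (mul_nonneg hβ0.le hxy)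
    linarith
  have hr : Real.sqrt 10 ^ 2 = 10 := Real.sq_sqrt (by norm_num)
  have hr3 : 3 < Real.sqrt 10 := Real.lt_sqrt_of_sq_lt (by norm_num)
  split_ifs with h₁ h₂
  · have hK : 2 - 3 / 2 * β ≤ 1 / (4 * β) := by
      rw [le_div_iff₀ (by positivity)]
      nlinarith [mul_nonneg (show 0 ≤ 4 - Real.sqrt 10 - 6 * β by linarith)
        (show 0 ≤ 4 + Real.sqrt 10 - 6 * β by linarith)]
    exact hsmall _ (by linarith) (by linarith) hK (by field_simp; rfl)
  · push Not at h₁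
    have := mul_nonneg (show 0 ≤ 6 * β - (4 - Real.sqrt 10) by linarith)
        (show 0 ≤ 4 + Real.sqrt 10 - 6 * β by linarith)
    exact hsmall _ (by linarith) (by linarith) (by linarith) (by nlinarith)
  · push Not at h₂
    rcases le_total β (3 / 4) with h | h
    · exact hsmall 1 h le_rfl (by linarith) (by linarith)
    · exact hlarge h

/-- Global upper bound `K_β` for the sectional curvature of the Stiefel manifold `St_β(n,p)`
for `β ∈ (0,1]`: for every β-orthonormal pair of tangent vectors `Δᵢ = (Aᵢ, Bᵢ)`, the sectional
curvature `𝒦_β(Δ₁,Δ₂)` (Nguyen's formula) satisfies `𝒦_β(Δ₁,Δ₂) ≤ K_β`, where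
`K_β = 1/(4β)` for `0 < β ≤ (4−√10)/6`, `K_β = (4−3β)/2` for `(4−√10)/6 < β ≤ 2/3`,
and `K_β = 1` for `2/3 ≤ β ≤ 1`. -/
theorem sectional_curvature_upper_bound (β : ℝ) (hβ0 : 0 < β) (hβ1 : β ≤ 1)
    (p q : ℕ) (hp : 0 < p) (hq : 0 < q)
    (A₁ A₂ : Matrix (Fin p) (Fin p) ℝ) (B₁ B₂ : Matrix (Fin q) (Fin p) ℝ)
    (hA₁ : A₁ᵀ = -A₁) (hA₂ : A₂ᵀ = -A₂)
    (hn₁ : β * frobSq A₁ + frobSq B₁ = 1) (hn₂ : β * frobSq A₂ + frobSq B₂ = 1)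
    (horth : β * Matrix.trace (A₁ᵀ * A₂) + Matrix.trace (B₁ᵀ * B₂) = 0) :
    (1 / 2) * frobSq (B₁ * B₂ᵀ - B₂ * B₁ᵀ) +
        ((1 - 2 * β) ^ 3 / 2) * frobSq (B₁ᵀ * B₂ - B₂ᵀ * B₁) +
        β ^ 2 * frobSq (B₁ * A₂ - B₂ * A₁) +
        (β / 4) * frobSq (A₁ * A₂ - A₂ * A₁ - (3 - 4 * β) • (B₁ᵀ * B₂ - B₂ᵀ * B₁)) ≤
      if β ≤ (4 - Real.sqrt 10) / 6 then 1 / (4 * β)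
      else if β ≤ 2 / 3 then (4 - 3 * β) / 2
      else 1 := by
  set M := B₁ * B₂ᵀ - B₂ * B₁ᵀ with hM
  set N := B₁ᵀ * B₂ - B₂ᵀ * B₁ with hN
  set C := A₁ * A₂ - A₂ * A₁ with hC
  have hMle : frobSq M ≤ 2 * (frobSq B₁ * frobSq B₂) := frobSq_mul_transpose_sub_le B₁ B₂
  have hNle : frobSq N ≤ 2 * (frobSq B₁ * frobSq B₂) := by
    have h := frobSq_mul_transpose_sub_le B₁ᵀ B₂ᵀ
    rwa [Matrix.transpose_transpose, Matrix.transpose_transpose, frobSq_transpose,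
      frobSq_transpose] at h
  have hCle : frobSq C ≤ frobSq A₁ * frobSq A₂ := frobSq_commutator_le_of_skew A₁ A₂ hA₁ hA₂
  have hTle := frobSq_sub_le (B₁ * A₂) (B₂ * A₁)
  have hBA₁ := frobSq_mul_le_of_skew B₂ A₁ hA₁
  have hBA₂ := frobSq_mul_le_of_skew B₁ A₂ hA₂
  have hCS := trace_transpose_mul_sq_le C N
  have hpos := frobSq_sub_smul N C β
  have hpos' := frobSq_nonneg (N - β • C)
  have hNC : (Nᵀ * C).trace = (Cᵀ * N).trace := by
    rw [← Matrix.trace_transpose, Matrix.transpose_mul, Matrix.transpose_transpose]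
  rw [hpos, hNC] at hpos'
  rw [frobSq_sub_smul C N (3 - 4 * β)]
  have hx₁ := frobSq_nonneg A₁
  have hx₂ := frobSq_nonneg A₂
  have hy₁ := frobSq_nonneg B₁
  have hy₂ := frobSq_nonneg B₂
  have hc := frobSq_nonneg C
  have hn := frobSq_nonneg N
  generalize frobSq (B₁ * A₂ - B₂ * A₁) = t at *
  generalize frobSq (B₁ * A₂) = t₁ at *
  generalize frobSq (B₂ * A₁) = t₂ at *
  generalize frobSq M = m at *
  generalize frobSq N = n at *
  generalize frobSq C = c at *
  generalize (Cᵀ * N).trace = s at *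
  generalize frobSq A₁ = x₁ at *
  generalize frobSq A₂ = x₂ at *
  generalize frobSq B₁ = y₁ at *
  generalize frobSq B₂ = y₂ at *
  exact curvature_scalar_bound hβ0 hβ1 hx₁ hx₂ hy₁ hy₂ hc hn hn₁ hn₂ hMle hNle hCle
    (by linarith) hCS (by linarith)
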